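/- Let Γ be a tail-triangle C-group of rank n+1 and let 0 ≤ j ≤ n−2 and μ ∈ Γ. If Γ_jμ ∩ Γ_{j+1} ≠ ∅ and, in case j ≥ 1, also Γ_jμ ∩ Γ_{j−1} ≠ ∅, then Γ_jμ = Γ_j or Γ_jμ = Γ_jα_j; moreover Γ_j ≠ Γ_jα_j, so there are exactly two cosets of Γ_j incident with both Γ_{j−1} and Γ_{j+1}. Similarly, for j = n−1 and either choice of Γ_n ∈ {Γ_n^P, Γ_n^Q}: if Γ_{n−1}μ ∩ Γ_{n−2} ≠ ∅ and Γ_{n−1}μ ∩ Γ_n ≠ ∅, then Γ_{n−1}μ = Γ_{n−1} or Γ_{n−1}μ = Γ_{n−1}γ, where γ = α_{n−1} if Γ_n = Γ_n^P and γ = β_{n−1} if Γ_n = Γ_n^Q (this is the diamond condition for the ranked coset poset). -/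

import Mathlib

/-!
Tail-triangle C-groups (Monson–Schulte, "Semiregular Polytopes and Amalgamated C-groups").

A tail-triangle group of rank `n+1` (`n ≥ 2`) is a group `G` generated by involutions
`α 0, …, α (n-1), β` (where `β` plays the role of `β_{n-1}`), with the commutation
relations of the tail-triangle diagram, and it is a tail-triangle C-group if it moreover
satisfies the intersection condition on its distinguished generating family.
The generating family is indexed by `Set.Iic n ⊆ ℕ`, with index `i < n` corresponding
to `α i` and index `n` corresponding to `β`.
-/

namespace TailTriangle

variable {G : Type*} [Group G]

/-- The combined generating family: index `i < n` gives `α i`, index `n` (or beyond) gives `β`. -/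
def ttGens (n : ℕ) (α : ℕ → G) (β : G) : ℕ → G := fun i => if i < n then α i else β

/-- The intersection condition on the generating family, for subsets of the index set `Iic n`. -/
def ttInterCond (n : ℕ) (α : ℕ → G) (β : G) : Prop :=
  ∀ I J : Set ℕ, I ⊆ Set.Iic n → J ⊆ Set.Iic n →
    Subgroup.closure (ttGens n α β '' I) ⊓ Subgroup.closure (ttGens n α β '' J)
      = Subgroup.closure (ttGens n α β '' (I ∩ J))

/-- A tail-triangle group of rank `n+1`. -/
structure IsTailTriangleGroup (n : ℕ) (α : ℕ → G) (β : G) : Prop where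
  two_le : 2 ≤ n
  orderOf_α : ∀ i < n, orderOf (α i) = 2
  orderOf_β : orderOf β = 2
  comm_αα : ∀ i j : ℕ, i + 2 ≤ j → j < n → Commute (α i) (α j)
  comm_αβ : ∀ i : ℕ, i + 3 ≤ n → Commute (α i) β
  closure_eq_top : Subgroup.closure (ttGens n α β '' Set.Iic n) = ⊤

/-- A tail-triangle C-group: a tail-triangle group satisfying the intersection condition. -/
def IsTailTriangleCGroup (n : ℕ) (α : ℕ → G) (β : G) : Prop :=
  IsTailTriangleGroup n α β ∧ ttInterCond n α β

/-- The distinguished subgroup `Γ_j` of rank `j`, for `0 ≤ j ≤ n-1`: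
for `j ≤ n-2` it is generated by all generators except `α j`;
`Γ_{n-1}` is generated by `α 0, …, α (n-2)`. -/
def ttΓ (n : ℕ) (α : ℕ → G) (β : G) (j : ℕ) : Subgroup G :=
  if j = n - 1 then Subgroup.closure (ttGens n α β '' {i | i < n - 1})
  else Subgroup.closure (ttGens n α β '' {i | i ≤ n ∧ i ≠ j})

/-- `Γ_n^P = ⟨α 0, …, α (n-1)⟩`. -/
def ttΓP (n : ℕ) (α : ℕ → G) (β : G) : Subgroup G :=
  Subgroup.closure (ttGens n α β '' {i | i < n})

/-- `Γ_n^Q = ⟨α 0, …, α (n-2), β⟩`. -/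
def ttΓQ (n : ℕ) (α : ℕ → G) (β : G) : Subgroup G :=
  Subgroup.closure (ttGens n α β '' {i | i ≤ n ∧ i ≠ n - 1})

/-- The rank-`j` subgroup where the Boolean `P` chooses `Γ_n^P` (if `true`) or `Γ_n^Q`
(if `false`) at rank `n`. -/
def ttΓ' (n : ℕ) (α : ℕ → G) (β : G) (P : Bool) (j : ℕ) : Subgroup G :=
  if j = n then (if P then ttΓP n α β else ttΓQ n α β) else ttΓ n α β j

/-- The right coset `H μ = {h * μ : h ∈ H}`. -/
def rcoset (H : Subgroup G) (μ : G) : Set G := (· * μ) '' (H : Set G)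

theorem rcoset_eq_iff {H : Subgroup G} {μ ν : G} :
    rcoset H μ = rcoset H ν ↔ μ * ν⁻¹ ∈ H := by
  constructor
  · intro h
    obtain ⟨x, hx, hxμ⟩ : μ ∈ rcoset H ν := h ▸ ⟨1, H.one_mem, one_mul μ⟩
    simpa [← hxμ] using hx
  · intro h
    ext x
    constructor
    · rintro ⟨y, hy, rfl⟩
      exact ⟨y * (μ * ν⁻¹), H.mul_mem hy h, by simp [mul_assoc]⟩
    · rintro ⟨y, hy, rfl⟩
      exact ⟨y * (μ * ν⁻¹)⁻¹, H.mul_mem hy (H.inv_mem h), by simp [mul_assoc]⟩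

/-- A right coset of `H` meeting `M` has a representative in `M`. -/
theorem exists_mem_of_rcoset_inter {H M : Subgroup G} {μ : G}
    (h : (rcoset H μ ∩ rcoset M 1).Nonempty) : ∃ m ∈ M, m * μ⁻¹ ∈ H := by
  obtain ⟨_, ⟨x, hx, rfl⟩, ⟨y, hy, hxy⟩⟩ := h
  simp only [mul_one] at hxy
  exact ⟨y, hy, by simpa [hxy] using hx⟩

/-- If `M ⊆ H L`, `N ⊆ H R` and `H = (H ∩ L)(H ∩ R)`, where `L ∩ R = ⟨γ⟩` for an involution `γ`,
then `H` and `H γ` are the only right cosets of `H` that can meet both `M` and `N`. -/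
theorem rcoset_eq_one_or_eq {H L R M N : Subgroup G} {γ μ : G} (hγ : γ ^ 2 = 1)
    (hLR : L ⊓ R ≤ Subgroup.closure {γ})
    (hM : ∀ m ∈ M, ∃ a ∈ H, ∃ l ∈ L, a * l = m)
    (hN : ∀ m ∈ N, ∃ a ∈ H, ∃ r ∈ R, a * r = m)
    (hH : ∀ m ∈ H, ∃ l ∈ H ⊓ L, ∃ r ∈ H ⊓ R, l * r = m)
    (hμM : ∃ m ∈ M, m * μ⁻¹ ∈ H) (hμN : ∃ m ∈ N, m * μ⁻¹ ∈ H) :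
    rcoset H μ = rcoset H 1 ∨ rcoset H μ = rcoset H γ := by
  obtain ⟨_, hm, hmμ⟩ := hμM
  obtain ⟨a, ha, l, hl, rfl⟩ := hM _ hm
  obtain ⟨_, hm', hmμ'⟩ := hμN
  obtain ⟨b, hb, r, hr, rfl⟩ := hN _ hm'
  have hlμ : l * μ⁻¹ ∈ H := by
    simpa [mul_assoc] using H.mul_mem (H.inv_mem ha) hmμ
  have hrμ : r * μ⁻¹ ∈ H := by
    simpa [mul_assoc] using H.mul_mem (H.inv_mem hb) hmμ'
  have hlr : l * r⁻¹ ∈ H := by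
    simpa [mul_assoc] using H.mul_mem hlμ (H.inv_mem hrμ)
  obtain ⟨c, hc, d, hd, hcd⟩ := hH _ hlr
  have heq : c⁻¹ * l = d * r := by
    rw [inv_mul_eq_iff_eq_mul, ← mul_assoc, hcd, inv_mul_cancel_right]
  have hmem : c⁻¹ * l ∈ L ⊓ R :=
    ⟨L.mul_mem (L.inv_mem hc.2) hl, heq ▸ R.mul_mem hd.2 hr⟩
  have hcoset : rcoset H μ = rcoset H (c⁻¹ * l) := by
    rw [rcoset_eq_iff]
    simpa [mul_assoc] using H.mul_mem (H.inv_mem hlμ) hc.1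
  obtain ⟨k, hk⟩ := Subgroup.mem_closure_singleton.1 (hLR hmem)
  rw [hcoset, ← hk]
  rcases Int.even_or_odd' k with ⟨t, rfl | rfl⟩
  · left
    simp [zpow_mul, hγ]
  · right
    simp [zpow_add, zpow_mul, hγ]

/-- If `S` is covered by two sets of indices whose generators commute pairwise, then each element
of the subgroup generated over `S` factors accordingly. -/
theorem exists_mul_eq_of_commute {ι : Type*} {g : ι → G} {S I K : Set ι} (hS : S ⊆ I ∪ K)
    (hc : ∀ i ∈ I, ∀ k ∈ K, Commute (g i) (g k)) {x : G} (hx : x ∈ Subgroup.closure (g '' S)) :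
    ∃ a ∈ Subgroup.closure (g '' I), ∃ b ∈ Subgroup.closure (g '' K), a * b = x := by
  have hle : Subgroup.closure (g '' I) ≤
      Subgroup.centralizer (Subgroup.closure (g '' K) : Set G) := by
    rw [Subgroup.centralizer_closure, Subgroup.closure_le]
    rintro _ ⟨i, hi, rfl⟩
    rw [SetLike.mem_coe, Subgroup.mem_centralizer_iff]
    rintro _ ⟨k, hk, rfl⟩
    exact (hc i hi k hk).symm
  have hcomm (a : Subgroup.closure (g '' I)) (b : Subgroup.closure (g '' K)) :
      Commute ((Subgroup.subtype _) a) ((Subgroup.subtype _) b) :=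
    (Subgroup.mem_centralizer_iff.1 (hle a.2) b b.2).symm
  have hx' : x ∈ Subgroup.closure (g '' I) ⊔ Subgroup.closure (g '' K) := by
    rw [← Subgroup.closure_union, ← Set.image_union]
    exact Subgroup.closure_mono (Set.image_mono hS) hx
  have hrange := MonoidHom.noncommCoprod_range _ _ hcomm
  rw [Subgroup.range_subtype, Subgroup.range_subtype] at hrange
  rw [← hrange] at hx'
  obtain ⟨⟨a, b⟩, rfl⟩ := hx'
  exact ⟨a, a.2, b, b.2, rfl⟩

theorem IsTailTriangleGroup.ttGens_sq {n : ℕ} {α : ℕ → G} {β : G}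
    (h : IsTailTriangleGroup n α β) (i : ℕ) : ttGens n α β i ^ 2 = 1 := by
  unfold ttGens
  split_ifs with hi
  · rw [← h.orderOf_α i hi, pow_orderOf_eq_one]
  · rw [← h.orderOf_β, pow_orderOf_eq_one]

theorem IsTailTriangleGroup.ttGens_ne_one {n : ℕ} {α : ℕ → G} {β : G}
    (h : IsTailTriangleGroup n α β) (i : ℕ) : ttGens n α β i ≠ 1 := by
  rw [ne_eq, ← orderOf_eq_one_iff]
  unfold ttGens
  split_ifs with hi
  · simp [h.orderOf_α i hi]
  · simp [h.orderOf_β]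

theorem IsTailTriangleGroup.commute_ttGens {n : ℕ} {α : ℕ → G} {β : G}
    (h : IsTailTriangleGroup n α β) {i k : ℕ} (hik : i + 2 ≤ k) (hi : i + 3 ≤ n) :
    Commute (ttGens n α β i) (ttGens n α β k) := by
  unfold ttGens
  rw [if_pos (by omega)]
  split_ifs with hk
  · exact h.comm_αα i k hik hk
  · exact h.comm_αβ i hi

/-- In a tail-triangle C-group, a generator lies outside the subgroup generated by others. -/
theorem IsTailTriangleCGroup.ttGens_notMem_closure {n : ℕ} {α : ℕ → G} {β : G}
    (h : IsTailTriangleCGroup n α β) {S : Set ℕ} {k : ℕ} (hS : S ⊆ Set.Iic n) (hk : k ≤ n)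
    (hkS : k ∉ S) : ttGens n α β k ∉ Subgroup.closure (ttGens n α β '' S) := by
  intro hmem
  have hinf : ttGens n α β k ∈
      Subgroup.closure (ttGens n α β '' S) ⊓ Subgroup.closure (ttGens n α β '' {k}) :=
    ⟨hmem, Subgroup.subset_closure ⟨k, rfl, rfl⟩⟩
  rw [h.2 S {k} hS (by simpa using hk), Set.inter_singleton_eq_empty.2 hkS] at hinf
  exact h.1.ttGens_ne_one k (by simpa using hinf)

/-- The diamond condition for subgroups of a tail-triangle C-group generated over index sets:
`H` is generated over `S ⊆ A ∪ B` with `A`, `B` commuting, and the cosets meet subgroups generated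
over `T ⊆ I ∪ K` and over `U ⊆ J ∪ V`, where `I, J ⊆ S` and `K ∩ V = {k}`. -/
theorem IsTailTriangleCGroup.rcoset_closure_eq_one_or_eq {n : ℕ} {α : ℕ → G} {β : G}
    (h : IsTailTriangleCGroup n α β) {S T U A B I J K V : Set ℕ} {k : ℕ} {μ : G}
    (hS : S ⊆ A ∪ B) (hT : T ⊆ I ∪ K) (hU : U ⊆ J ∪ V)
    (hAS : A ⊆ S) (hBS : B ⊆ S) (hIS : I ⊆ S) (hJS : J ⊆ S) (hAK : A ⊆ K) (hBV : B ⊆ V)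
    (hK : K ⊆ Set.Iic n) (hV : V ⊆ Set.Iic n) (hKV : K ∩ V ⊆ {k})
    (hAB : ∀ a ∈ A, ∀ b ∈ B, Commute (ttGens n α β a) (ttGens n α β b))
    (hIK : ∀ a ∈ I, ∀ b ∈ K, Commute (ttGens n α β a) (ttGens n α β b))
    (hJV : ∀ a ∈ J, ∀ b ∈ V, Commute (ttGens n α β a) (ttGens n α β b))
    (hμT : ∃ m ∈ Subgroup.closure (ttGens n α β '' T),
      m * μ⁻¹ ∈ Subgroup.closure (ttGens n α β '' S))
    (hμU : ∃ m ∈ Subgroup.closure (ttGens n α β '' U),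
      m * μ⁻¹ ∈ Subgroup.closure (ttGens n α β '' S)) :
    rcoset (Subgroup.closure (ttGens n α β '' S)) μ
        = rcoset (Subgroup.closure (ttGens n α β '' S)) 1 ∨
      rcoset (Subgroup.closure (ttGens n α β '' S)) μ
        = rcoset (Subgroup.closure (ttGens n α β '' S)) (ttGens n α β k) := by
  have mono {X Y : Set ℕ} (hXY : X ⊆ Y) :
      Subgroup.closure (ttGens n α β '' X) ≤ Subgroup.closure (ttGens n α β '' Y) :=
    Subgroup.closure_mono (Set.image_mono hXY)
  refine rcoset_eq_one_or_eq (L := Subgroup.closure (ttGens n α β '' K))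
    (R := Subgroup.closure (ttGens n α β '' V)) (h.1.ttGens_sq k) ?_ ?_ ?_ ?_ hμT hμU
  · rw [h.2 K V hK hV, ← Set.image_singleton]
    exact mono hKV
  · intro m hm
    obtain ⟨a, ha, b, hb, hab⟩ := exists_mul_eq_of_commute hT hIK hm
    exact ⟨a, mono hIS ha, b, hb, hab⟩
  · intro m hm
    obtain ⟨a, ha, b, hb, hab⟩ := exists_mul_eq_of_commute hU hJV hm
    exact ⟨a, mono hJS ha, b, hb, hab⟩
  · intro m hm
    obtain ⟨a, ha, b, hb, hab⟩ := exists_mul_eq_of_commute hS hAB hm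
    exact ⟨a, ⟨mono hAS ha, mono hAK ha⟩, b, ⟨mono hBS hb, mono hBV hb⟩, hab⟩

/-- The diamond condition for the ranked coset poset of a tail-triangle C-group.
For `0 ≤ j ≤ n-2`: the two cosets `Γ_j` and `Γ_j (α j)` are distinct, and any coset
`Γ_j μ` incident with `Γ_{j+1}` (and with `Γ_{j-1}`, if `j ≥ 1`) is one of them.
For `j = n-1` and either choice of `Γ_n ∈ {Γ_n^P, Γ_n^Q}` (selected by `P`): the cosets
`Γ_{n-1}` and `Γ_{n-1} γ` (with `γ = α (n-1)` for `Γ_n^P`, `γ = β` for `Γ_n^Q`) are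
distinct, and any coset `Γ_{n-1} μ` incident with both `Γ_{n-2}` and `Γ_n` is one of them. -/
theorem diamond_condition
    (n : ℕ) (α : ℕ → G) (β : G) (h : IsTailTriangleCGroup n α β) :
    (∀ j : ℕ, j ≤ n - 2 →
      rcoset (ttΓ n α β j) 1 ≠ rcoset (ttΓ n α β j) (α j) ∧
      ∀ μ : G,
        (rcoset (ttΓ n α β j) μ ∩ rcoset (ttΓ n α β (j + 1)) 1).Nonempty →
        (1 ≤ j → (rcoset (ttΓ n α β j) μ ∩ rcoset (ttΓ n α β (j - 1)) 1).Nonempty) →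
        rcoset (ttΓ n α β j) μ = rcoset (ttΓ n α β j) 1 ∨
          rcoset (ttΓ n α β j) μ = rcoset (ttΓ n α β j) (α j)) ∧
    (∀ P : Bool,
      rcoset (ttΓ n α β (n - 1)) 1
          ≠ rcoset (ttΓ n α β (n - 1)) (if P then α (n - 1) else β) ∧
      ∀ μ : G,
        (rcoset (ttΓ n α β (n - 1)) μ ∩ rcoset (ttΓ n α β (n - 2)) 1).Nonempty →
        (rcoset (ttΓ n α β (n - 1)) μ ∩
            rcoset (if P then ttΓP n α β else ttΓQ n α β) 1).Nonempty →
        rcoset (ttΓ n α β (n - 1)) μ = rcoset (ttΓ n α β (n - 1)) 1 ∨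
          rcoset (ttΓ n α β (n - 1)) μ
            = rcoset (ttΓ n α β (n - 1)) (if P then α (n - 1) else β)) := by
  have hn := h.1.two_le
  have hdist {S : Set ℕ} {k : ℕ} (hS : S ⊆ Set.Iic n) (hk : k ≤ n) (hkS : k ∉ S) :
      rcoset (Subgroup.closure (ttGens n α β '' S)) 1
        ≠ rcoset (Subgroup.closure (ttGens n α β '' S)) (ttGens n α β k) := by
    rw [ne_eq, rcoset_eq_iff, one_mul, inv_mem_iff]
    exact h.ttGens_notMem_closure hS hk hkS
  refine ⟨fun j hj ↦ ?_, fun P ↦ ?_⟩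
  · have hα : α j = ttGens n α β j := (if_pos (by omega)).symm
    have hΓ : ttΓ n α β j = Subgroup.closure (ttGens n α β '' {i | i ≤ n ∧ i ≠ j}) :=
      if_neg (by omega)
    rw [hα, hΓ]
    refine ⟨hdist (fun i hi ↦ hi.1) (by omega) (fun hi ↦ hi.2 rfl), fun μ hμ₁ hμ₂ ↦ ?_⟩
    refine h.rcoset_closure_eq_one_or_eq (T := {i | i ≤ n ∧ (j + 1 = n - 1 → i ≤ j) ∧ i ≠ j + 1})
      (U := {i | i ≤ n ∧ i + 1 ≠ j}) (A := {i | i < j}) (B := {i | j + 1 ≤ i ∧ i ≤ n})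
      (I := {i | j + 2 ≤ i ∧ i ≤ n ∧ j + 3 ≤ n}) (K := {i | i ≤ j})
      (J := {i | i + 2 ≤ j}) (V := {i | j ≤ i ∧ i ≤ n})
      ?_ ?_ ?_ ?_ ?_ ?_ ?_ ?_ ?_ ?_ ?_ ?_ ?_ ?_ ?_ ?_ ?_
    · intro i; simp; omega
    · intro i; simp; omega
    · intro i; simp; omega
    · intro i; simp; omega
    · intro i; simp; omega
    · intro i; simp; omega
    · intro i; simp; omega
    · intro i; simp; omega
    · intro i; simp; omega
    · intro i; simp; omega
    · intro i; simp
    · intro i; simp; omega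
    · rintro a ha b ⟨hb, hbn⟩
      simp only [Set.mem_ofPred_eq] at ha
      exact h.1.commute_ttGens (by omega) (by omega)
    · rintro a ⟨ha, han, hjn⟩ b hb
      simp only [Set.mem_ofPred_eq] at hb
      exact (h.1.commute_ttGens (by omega) (by omega)).symm
    · rintro a ha b ⟨hb, hbn⟩
      simp only [Set.mem_ofPred_eq] at ha
      exact h.1.commute_ttGens (by omega) (by omega)
    · obtain ⟨m, hm, hmμ⟩ := exists_mem_of_rcoset_inter hμ₁
      refine ⟨m, ?_, hmμ⟩
      unfold ttΓ at hm
      split_ifs at hm with hjn <;>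
        refine Subgroup.closure_mono (Set.image_mono fun i ↦ ?_) hm <;> simp <;> omega
    · by_cases hj₁ : 1 ≤ j
      · obtain ⟨m, hm, hmμ⟩ := exists_mem_of_rcoset_inter (hμ₂ hj₁)
        refine ⟨m, ?_, hmμ⟩
        unfold ttΓ at hm
        rw [if_neg (by omega)] at hm
        refine Subgroup.closure_mono (Set.image_mono fun i ↦ ?_) hm
        simp
        omega
      · refine ⟨μ, ?_, by simp⟩
        have hset : {i | i ≤ n ∧ i + 1 ≠ j} = Set.Iic n := by
          ext i; simp; omega
        rw [hset, h.1.closure_eq_top]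
        trivial
  · obtain ⟨k, hk, hk₁, hγ, hΓ⟩ : ∃ k ≤ n, n - 1 ≤ k ∧
        (if P then α (n - 1) else β) = ttGens n α β k ∧
        (if P then ttΓP n α β else ttΓQ n α β) =
          Subgroup.closure (ttGens n α β '' {i | i < n - 1 ∨ i = k}) := by
      cases P
      · refine ⟨n, le_rfl, by omega, by simp [ttGens], ?_⟩
        have hset : {i | i ≤ n ∧ i ≠ n - 1} = {i | i < n - 1 ∨ i = n} := by
          ext i; simp; omega
        simp [ttΓQ, ← hset]
      · refine ⟨n - 1, by omega, le_rfl, by simp [ttGens]; omega, ?_⟩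
        have hset : {i | i < n} = {i | i < n - 1 ∨ i = n - 1} := by
          ext i; simp; omega
        simp [ttΓP, ← hset]
    have hΓ₁ : ttΓ n α β (n - 1) = Subgroup.closure (ttGens n α β '' {i | i < n - 1}) :=
      if_pos rfl
    have hΓ₂ : ttΓ n α β (n - 2) = Subgroup.closure (ttGens n α β '' {i | i ≤ n ∧ i ≠ n - 2}) :=
      if_neg (by omega)
    rw [hγ, hΓ, hΓ₁, hΓ₂]
    refine ⟨hdist (fun i ↦ ?_) hk ?_, fun μ hμ₁ hμ₂ ↦ ?_⟩
    · simp; omega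
    · simp; omega
    refine h.rcoset_closure_eq_one_or_eq (A := {i | i < n - 1}) (B := ∅) (I := ∅)
      (K := {i | i < n - 1 ∨ i = k}) (J := {i | i < n - 2}) (V := {i | n - 1 ≤ i ∧ i ≤ n})
      ?_ ?_ ?_ ?_ ?_ ?_ ?_ ?_ ?_ ?_ ?_ ?_ ?_ ?_ ?_
      (exists_mem_of_rcoset_inter hμ₂) (exists_mem_of_rcoset_inter hμ₁)
    · simp
    · simp
    · intro i; simp; omega
    · exact subset_rfl
    · simp
    · simp
    · intro i; simp; omega
    · intro i; simp; omega
    · simp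
    · intro i; simp; omega
    · intro i; simp
    · intro i; simp; omega
    · simp
    · simp
    · rintro a ha b ⟨hb, hbn⟩
      simp only [Set.mem_ofPred_eq] at ha
      exact h.1.commute_ttGens (by omega) (by omega)
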